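/- Let k be a field of characteristic zero and (S, t) a wheelspace. Let H denote the set of sequences f = (f(m) : S(m) → S(m+1))_{m ≥ 0} of k-linear maps satisfying f(m)(σ·v·τ) = 𝕗_{m,m+1}(σ) · f(m)(v) · 𝕗_{m,m+1}(τ) for all σ, τ ∈ S_m and t^{m+1}_{j+1,i+1}(f(m)(v)) = f(m−1)(t^m_{j,i}(v)) for all m ≥ 1 and i, j ∈ {1,…,m}. For f, g ∈ H define (f · g)(m) := t^{m+2}_{2,1} ∘ g(m+1) ∘ f(m). Then f · g again lies in H, and this product is associative: (f · g) · h = f · (g · h) for all f, g, h ∈ H. Hence the degree-one internal homomorphism space IHom_W(S,S)(1) is an associative (nonunital) k-algebra. -/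

import Mathlib

/-- The cycle `(a … b)` inside the group of permutations of `ℕ` (1-indexed):
it sends `j` to `j + 1` for `a ≤ j < b`, sends `b` to `a`, and fixes every
other natural number. -/
def cyc (a b : ℕ) : Equiv.Perm ℕ :=
  ((List.range' a (b - a)).map fun j => Equiv.swap j (j + 1)).prod

/-- Membership in `S_n ⊆ Perm ℕ` (1-indexed): `σ` fixes `0` and all `j > n`. -/
def memS (n : ℕ) (σ : Equiv.Perm ℕ) : Prop :=
  ∀ j : ℕ, j = 0 ∨ n < j → σ j = j

/-- `r^n_i(σ)`, realized inside `Perm ℕ` via the conjugation formula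
`e_{n-1}(r^n_i(σ)) = (σ(i) … n)⁻¹ σ (i … n)` (for `σ ∈ S_n` this agrees with
the defining piecewise formula on `{1,…,n-1}` and fixes everything else). -/
def rP (n i : ℕ) (σ : Equiv.Perm ℕ) : Equiv.Perm ℕ :=
  (cyc (σ i) n)⁻¹ * σ * cyc i n

/-- `l^n_i(σ) := (r^n_i(σ⁻¹))⁻¹`. -/
def lP (n i : ℕ) (σ : Equiv.Perm ℕ) : Equiv.Perm ℕ :=
  (rP n i σ⁻¹)⁻¹

/-- The block transposition `b_{a,b}(1 2) ∈ S_{a+b}` (1-indexed): it sends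
`j ↦ j + b` for `1 ≤ j ≤ a`, `j ↦ j - a` for `a < j ≤ a + b`, and fixes
everything else. -/
def blockT (a b : ℕ) : Equiv.Perm ℕ := cyc 1 (a + b) ^ b

/-- The block-diagonal embedding `s_{n,m} : S_n × S_m → S_{n+m}`: `σ ∈ S_n`
acts on `{1,…,n}` as itself and `σ' ∈ S_m` acts, shifted by `n`, on
`{n+1,…,n+m}`. -/
def sEmb (n m : ℕ) (σ σ' : Equiv.Perm ℕ) : Equiv.Perm ℕ :=
  σ * (blockT m n * σ' * (blockT m n)⁻¹)
/-- A diagonal `𝕊`-bimodule structure on the family of `k`-vector spaces `S`: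
for each `n`, commuting `k`-linear left and right actions of `S_n` on `S n`,
the left action being `σ·v = L n σ v` and the right action `v·τ = R n τ v`
(only the values on permutations belonging to `S_n` are relevant). -/
def IsDiagAction (k : Type) [Field k] (S : ℕ → Type)
    [∀ n, AddCommGroup (S n)] [∀ n, Module k (S n)]
    (L R : ∀ n, Equiv.Perm ℕ → S n →ₗ[k] S n) : Prop :=
  ∀ n : ℕ,
    (∀ v : S n, L n 1 v = v ∧ R n 1 v = v) ∧
    (∀ σ τ : Equiv.Perm ℕ, memS n σ → memS n τ → ∀ v : S n,
      L n (σ * τ) v = L n σ (L n τ v) ∧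
      R n (σ * τ) v = R n τ (R n σ v) ∧
      L n σ (R n τ v) = R n τ (L n σ v))

/-- The family of contractions `t^{n+1}_{j,i} = t n j i : S (n+1) → S n`
(`1 ≤ i, j ≤ n+1`) makes the diagonal `𝕊`-bimodule `S` a wheelspace:
axiom (W.1): `t^n_{j,i}(σ·v·τ) = l^n_j(σ) · t^n_{σ⁻¹(j),τ(i)}(v) · r^n_i(τ)`,
and axiom (W.2): `t^n_{j,i} ∘ t^{n+1}_{ℓ,k} = t^n_{j',i'} ∘ t^{n+1}_{ℓ',k'}`
where `(i',k') = (k-1,i)` if `i < k`, `(i',k') = (k,i+1)` if `k ≤ i`, and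
`(j',ℓ')` is obtained from `(j,ℓ)` by the same rule. -/
def IsWheel (k : Type) [Field k] (S : ℕ → Type)
    [∀ n, AddCommGroup (S n)] [∀ n, Module k (S n)]
    (L R : ∀ n, Equiv.Perm ℕ → S n →ₗ[k] S n)
    (t : ∀ n : ℕ, ℕ → ℕ → (S (n + 1) →ₗ[k] S n)) : Prop :=
  (∀ n i j : ℕ, 1 ≤ i → i ≤ n + 1 → 1 ≤ j → j ≤ n + 1 →
    ∀ σ τ : Equiv.Perm ℕ, memS (n + 1) σ → memS (n + 1) τ → ∀ v : S (n + 1),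
      t n j i (L (n + 1) σ (R (n + 1) τ v)) =
        L n (lP (n + 1) j σ) (R n (rP (n + 1) i τ) (t n (σ⁻¹ j) (τ i) v))) ∧
  (∀ n i j a b : ℕ, 1 ≤ i → i ≤ n + 1 → 1 ≤ j → j ≤ n + 1 →
    1 ≤ a → a ≤ n + 2 → 1 ≤ b → b ≤ n + 2 → ∀ v : S (n + 2),
      t n j i (t (n + 1) b a v) =
        t n (if j < b then b - 1 else b) (if i < a then a - 1 else a)
          (t (n + 1) (if j < b then j else j + 1) (if i < a then i else i + 1) v))

/-- The group embedding `𝕗_{m,m+1} : S_m → S_{m+1}` fixing `1` and sending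
`i + 1` to `σ(i) + 1`, realized in `Perm ℕ` as conjugation by the cycle
`(1 … m+1)`. -/
def fEmb (m : ℕ) (σ : Equiv.Perm ℕ) : Equiv.Perm ℕ :=
  cyc 1 (m + 1) * σ * (cyc 1 (m + 1))⁻¹

/-- `f` belongs to the degree-one internal homomorphism space
`IHom_W(S,S)(1)`: it is a sequence of `k`-linear maps
`f m : S m → S (m+1)` with `f m (σ·v·τ) = 𝕗_{m,m+1}(σ) · f m (v) · 𝕗_{m,m+1}(τ)`
and `t^{m+1}_{j+1,i+1}(f m (v)) = f (m-1) (t^m_{j,i}(v))`. -/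
def MemIHomOne (k : Type) [Field k] (S : ℕ → Type)
    [∀ n, AddCommGroup (S n)] [∀ n, Module k (S n)]
    (L R : ∀ n, Equiv.Perm ℕ → S n →ₗ[k] S n)
    (t : ∀ n : ℕ, ℕ → ℕ → (S (n + 1) →ₗ[k] S n))
    (f : ∀ m : ℕ, S m →ₗ[k] S (m + 1)) : Prop :=
  (∀ (m : ℕ) (σ τ : Equiv.Perm ℕ), memS m σ → memS m τ → ∀ v : S m,
      f m (L m σ (R m τ v)) =
        L (m + 1) (fEmb m σ) (R (m + 1) (fEmb m τ) (f m v))) ∧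
  (∀ m i j : ℕ, 1 ≤ i → i ≤ m + 1 → 1 ≤ j → j ≤ m + 1 → ∀ v : S (m + 1),
      t (m + 1) (j + 1) (i + 1) (f (m + 1) v) = f m (t m j i v))

/-- The product `(f · g)(m) := t^{m+2}_{2,1} ∘ g (m+1) ∘ f m` on the
degree-one internal homomorphism space. -/
def ihomOneMul (k : Type) [Field k] (S : ℕ → Type)
    [∀ n, AddCommGroup (S n)] [∀ n, Module k (S n)]
    (t : ∀ n : ℕ, ℕ → ℕ → (S (n + 1) →ₗ[k] S n))
    (f g : ∀ m : ℕ, S m →ₗ[k] S (m + 1)) :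
    ∀ m : ℕ, S m →ₗ[k] S (m + 1) :=
  fun m => t (m + 1) 2 1 ∘ₗ g (m + 1) ∘ₗ f m

theorem cyc_eq_swap_mul {a b : ℕ} (h : a < b) :
    cyc a b = Equiv.swap a (a + 1) * cyc (a + 1) b := by
  obtain ⟨d, rfl⟩ := Nat.exists_eq_add_of_lt h
  have h₁ : a + d + 1 - a = d + 1 := by omega
  have h₂ : a + d + 1 - (a + 1) = d := by omega
  simp [cyc, h₁, h₂, List.range'_succ]

theorem cyc_self (a : ℕ) : cyc a a = 1 := by simp [cyc]

theorem cyc_apply_of_lt_or_gt {a b j : ℕ} (hab : a ≤ b) (hj : j < a ∨ b < j) :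
    cyc a b j = j := by
  induction hab using Nat.decreasingInduction with
  | self => simp [cyc_self]
  | of_succ a hab ih =>
    rw [cyc_eq_swap_mul hab, Equiv.Perm.mul_apply, ih (by omega)]
    exact Equiv.swap_apply_of_ne_of_ne (by omega) (by omega)

theorem cyc_apply_right {a b : ℕ} (hab : a ≤ b) : cyc a b b = a := by
  induction hab using Nat.decreasingInduction with
  | self => simp [cyc_self]
  | of_succ a hab ih => rw [cyc_eq_swap_mul hab, Equiv.Perm.mul_apply, ih, Equiv.swap_apply_right]

theorem cyc_apply_left {a b : ℕ} (hab : a < b) : cyc a b a = a + 1 := by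
  rw [cyc_eq_swap_mul hab, Equiv.Perm.mul_apply, cyc_apply_of_lt_or_gt hab (by omega),
    Equiv.swap_apply_left]

theorem memS.mul {n : ℕ} {σ τ : Equiv.Perm ℕ} (hσ : memS n σ) (hτ : memS n τ) :
    memS n (σ * τ) := fun j hj => by
  rw [Equiv.Perm.mul_apply, hτ j hj, hσ j hj]

theorem memS.inv {n : ℕ} {σ : Equiv.Perm ℕ} (hσ : memS n σ) : memS n σ⁻¹ := fun j hj =>
  Equiv.Perm.inv_eq_iff_eq.2 (hσ j hj).symm

theorem memS.mono {m n : ℕ} (hmn : m ≤ n) {σ : Equiv.Perm ℕ} (hσ : memS m σ) : memS n σ :=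
  fun j hj => hσ j (by omega)

theorem memS_cyc_one (n : ℕ) : memS (n + 1) (cyc 1 (n + 1)) := fun _ hj =>
  cyc_apply_of_lt_or_gt (by omega) (by omega)

theorem memS.fEmb {m : ℕ} {σ : Equiv.Perm ℕ} (hσ : memS m σ) : memS (m + 1) (fEmb m σ) :=
  ((memS_cyc_one m).mul (hσ.mono m.le_succ)).mul (memS_cyc_one m).inv

theorem fEmb_apply_one {m : ℕ} {σ : Equiv.Perm ℕ} (hσ : memS m σ) : fEmb m σ 1 = 1 := by
  have h : (cyc 1 (m + 1))⁻¹ 1 = m + 1 :=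
    Equiv.Perm.inv_eq_iff_eq.2 (cyc_apply_right (by omega)).symm
  rw [fEmb, Equiv.Perm.mul_apply, Equiv.Perm.mul_apply, h, hσ _ (by omega),
    cyc_apply_right (by omega)]

theorem fEmb_fEmb_apply_two {m : ℕ} {σ : Equiv.Perm ℕ} (hσ : memS m σ) :
    fEmb (m + 1) (fEmb m σ) 2 = 2 := by
  have h : cyc 1 (m + 1 + 1) 1 = 2 := cyc_apply_left (by omega)
  have h' : (cyc 1 (m + 1 + 1))⁻¹ 2 = 1 := Equiv.Perm.inv_eq_iff_eq.2 h.symm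
  rw [fEmb, Equiv.Perm.mul_apply, Equiv.Perm.mul_apply, h', fEmb_apply_one hσ, h]

theorem rP_one_fEmb_fEmb {m : ℕ} {σ : Equiv.Perm ℕ} (hσ : memS m σ) :
    rP (m + 2) 1 (fEmb (m + 1) (fEmb m σ)) = fEmb m σ := by
  rw [rP, fEmb_apply_one hσ.fEmb, fEmb]
  group

theorem lP_two_fEmb_fEmb {m : ℕ} {σ : Equiv.Perm ℕ} (hσ : memS m σ) :
    lP (m + 2) 2 (fEmb (m + 1) (fEmb m σ)) = fEmb m σ := by
  have h2 : (fEmb (m + 1) (fEmb m σ))⁻¹ 2 = 2 :=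
    Equiv.Perm.inv_eq_iff_eq.2 (fEmb_fEmb_apply_two hσ).symm
  have hcyc : cyc 1 (m + 1 + 1) = Equiv.swap 1 2 * cyc 2 (m + 2) := cyc_eq_swap_mul (by omega)
  have hconj : (cyc 2 (m + 2))⁻¹ * Equiv.swap 1 2 * cyc 2 (m + 2) = Equiv.swap 1 (m + 2) := by
    rw [mul_assoc, Equiv.swap_mul_eq_mul_swap, inv_mul_cancel_left,
      Equiv.Perm.inv_eq_iff_eq.2 (cyc_apply_of_lt_or_gt (a := 2) (b := m + 2) (j := 1)
        (by omega) (by omega)).symm,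
      Equiv.Perm.inv_eq_iff_eq.2 (cyc_apply_right (a := 2) (b := m + 2) (by omega)).symm]
  have hcomm : Equiv.swap 1 (m + 2) * fEmb m σ = fEmb m σ * Equiv.swap 1 (m + 2) := by
    rw [Equiv.mul_swap_eq_swap_mul, fEmb_apply_one hσ, hσ.fEmb (m + 2) (by omega)]
  calc lP (m + 2) 2 (fEmb (m + 1) (fEmb m σ))
      = ((cyc 2 (m + 2))⁻¹ * Equiv.swap 1 2 * cyc 2 (m + 2)) * fEmb m σ *
          ((cyc 2 (m + 2))⁻¹ * Equiv.swap 1 2 * cyc 2 (m + 2))⁻¹ := by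
        rw [lP, rP, h2, fEmb, hcyc]
        group
    _ = fEmb m σ := by rw [hconj, hcomm, mul_inv_cancel_right]

/-- The degree-one internal homomorphism space `IHom_W(S,S)(1)` of a
wheelspace `S` is an associative (nonunital) `k`-algebra: the product
`(f · g)(m) := t^{m+2}_{2,1} ∘ g (m+1) ∘ f m` of two of its members again
belongs to it, and this product is associative. -/
theorem ihomOne_assoc (k : Type) [Field k] (S : ℕ → Type)
    [∀ n, AddCommGroup (S n)] [∀ n, Module k (S n)]
    (L R : ∀ n, Equiv.Perm ℕ → S n →ₗ[k] S n)
    (t : ∀ n : ℕ, ℕ → ℕ → (S (n + 1) →ₗ[k] S n))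
    (hLR : IsDiagAction k S L R) (hw : IsWheel k S L R t) :
    (∀ f g : ∀ m : ℕ, S m →ₗ[k] S (m + 1),
        MemIHomOne k S L R t f → MemIHomOne k S L R t g →
        MemIHomOne k S L R t (ihomOneMul k S t f g)) ∧
    (∀ f g h : ∀ m : ℕ, S m →ₗ[k] S (m + 1),
        MemIHomOne k S L R t f → MemIHomOne k S L R t g →
        MemIHomOne k S L R t h →
        ∀ (m : ℕ) (v : S m),
          ihomOneMul k S t (ihomOneMul k S t f g) h m v =
            ihomOneMul k S t f (ihomOneMul k S t g h) m v) := by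
  refine ⟨fun f g hf hg => ⟨fun m σ τ hσ hτ v => ?_, fun m i j hi hi' hj hj' v => ?_⟩,
    fun f g h _ _ hh m v => ?_⟩
  · simp only [ihomOneMul, LinearMap.comp_apply]
    rw [hf.1 m σ τ hσ hτ, hg.1 (m + 1) _ _ hσ.fEmb hτ.fEmb,
      hw.1 (m + 1) 1 2 (by omega) (by omega) (by omega) (by omega) _ _ hσ.fEmb.fEmb hτ.fEmb.fEmb,
      lP_two_fEmb_fEmb hσ, rP_one_fEmb_fEmb hτ, fEmb_apply_one hτ.fEmb,
      Equiv.Perm.inv_eq_iff_eq.2 (fEmb_fEmb_apply_two hσ).symm]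
  · simp only [ihomOneMul, LinearMap.comp_apply]
    rw [hw.2 (m + 1) (i + 1) (j + 1) 1 2 (by omega) (by omega) (by omega) (by omega) (by omega)
        (by omega) (by omega) (by omega),
      if_neg (by omega), if_neg (by omega), if_neg (by omega), if_neg (by omega),
      hg.2 (m + 1) (i + 1) (j + 1) (by omega) (by omega) (by omega) (by omega),
      hf.2 m i j hi hi' hj hj']
  · simp only [ihomOneMul, LinearMap.comp_apply]
    rw [← hh.2 (m + 1) 1 2 (by omega) (by omega) (by omega) (by omega),
      hw.2 (m + 1) 1 2 2 3 (by omega) (by omega) (by omega) (by omega) (by omega)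
        (by omega) (by omega) (by omega)]
    rfl
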